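/- arXiv:2006.08049 — 8 statements merged into one kernel-verified Lean document; each statement's English description precedes it below -/
import Mathlib

section
/- Let n ≥ 3 be an integer, let α ∈ (0,1), and let η ∈ (0, 1/(n−2+α) − 1/(n−1)). Then there exists a constant γ > 0 (depending only on n, α, η) such that for every vector λ = (λ₁,…,λₙ) ∈ ℝⁿ satisfying |λ|² − (1/(n−1) + η)·(tr λ)² ≥ 0 and |λ|² − (tr λ)²/(n−2+α) − 2(2−α) ≤ 0, one has γ·W(λ)³ ≤ |C(λ)|² + 1. -/
theorem aux_pos (n : ℕ) (hn : 3 ≤ n) (α η : ℝ) (hα0 : 0 < α)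
    (hη0 : 0 < η) (m : Fin n → ℝ) (hT : (∑ i, m i) ^ 2 = 1)
    (h1 : 1 / ((n : ℝ) - 1) + η ≤ ∑ i, (m i) ^ 2)
    (h2 : ∑ i, (m i) ^ 2 ≤ 1 / ((n : ℝ) - 2 + α))
    (h : ∀ i j, (m j - m i) ^ 2 * (m i * m j) ^ 2 = 0) : False := by
  have hn' : (3 : ℝ) ≤ n := by exact_mod_cast hn
  obtain ⟨i0, hi0⟩ : ∃ i, m i ≠ 0 := by
    by_contra! hc
    simp [hc] at hT
  set c := m i0 with hc
  have hm : ∀ i, m i = if m i ≠ 0 then c else 0 := by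
    intro i
    by_cases hi : m i = 0
    · simp [hi]
    · have := h i0 i
      rw [mul_eq_zero, pow_eq_zero_iff two_ne_zero, pow_eq_zero_iff two_ne_zero] at this
      rcases this with h | h
      · simp only [ne_eq, hi, not_false_eq_true, if_true]; linarith
      · exact absurd h (mul_ne_zero hi0 hi)
  set k := (Finset.univ.filter fun i => m i ≠ 0).card with hk
  have e1 : ∑ i, m i = k * c := by
    rw [Finset.sum_congr rfl (fun i _ => hm i), ← Finset.sum_filter]
    simp [hk]
  have e2 : ∑ i, (m i) ^ 2 = k * c ^ 2 := by
    have : ∀ i, (m i) ^ 2 = if m i ≠ 0 then c ^ 2 else 0 := by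
      intro i
      by_cases hi : m i = 0
      · simp [hi]
      · have := hm i
        simp only [ne_eq, hi, not_false_eq_true, if_true] at this ⊢
        rw [this]
    rw [Finset.sum_congr rfl (fun i _ => this i), ← Finset.sum_filter]
    simp [hk]
  rw [e1] at hT
  rw [e2] at h1 h2
  set q := (k : ℝ) * c ^ 2 with hq
  have hkq : k * q = 1 := by rw [hq, ← hT]; ring
  have hk0 : (0 : ℝ) ≤ k := Nat.cast_nonneg k
  have hkp : (0 : ℝ) < k := by
    rcases hk0.eq_or_lt with h | h
    · rw [← h] at hkq; norm_num at hkq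
    · exact h
  have hq1 : 1 < ((n : ℝ) - 1) * q := by
    have : 1 / ((n : ℝ) - 1) < q := by linarith
    rw [div_lt_iff₀ (by linarith)] at this
    linarith
  have hq2 : ((n : ℝ) - 2 + α) * q ≤ 1 := by
    rw [le_div_iff₀ (by linarith)] at h2
    linarith
  have hqp : 0 < q := by
    by_contra! hc
    nlinarith
  have a1 : (k : ℝ) < n - 1 := by
    by_contra! hc
    nlinarith
  have a2 : (n : ℝ) - 2 + α ≤ k := by
    by_contra! hc
    nlinarith
  have b1 : k + 1 < n := by
    have : ((k + 1 : ℕ) : ℝ) < n := by push_cast; linarith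
    exact_mod_cast this
  have b2 : n < k + 2 := by
    have : (n : ℝ) < ((k + 2 : ℕ) : ℝ) := by push_cast; linarith
    exact_mod_cast this
  omega


/-- The key algebraic inequality (case `K = 1`) behind the
Poincaré-type inequality: on the "acylindrical" set where the principal
curvature vector `l` is quadratically pinched but not `η`-close to cylindrical,
the norm of the Simons tensor `C` controls `W³`. -/
theorem quadratic_pinching_poincare_key_inequality
    (n : ℕ) (hn : 3 ≤ n) (α η : ℝ) (hα0 : 0 < α) (hα1 : α < 1)
    (hη0 : 0 < η) (hη1 : η < 1 / ((n : ℝ) - 2 + α) - 1 / ((n : ℝ) - 1)) :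
    ∃ γ : ℝ, 0 < γ ∧
      ∀ l : Fin n → ℝ,
        (∑ i, (l i) ^ 2) - (1 / ((n : ℝ) - 1) + η) * (∑ i, l i) ^ 2 ≥ 0 →
        (∑ i, (l i) ^ 2) - (∑ i, l i) ^ 2 / ((n : ℝ) - 2 + α) - 2 * (2 - α) ≤ 0 →
        γ * ((1 / ((n : ℝ) - 2 + α) - 1 / ((n : ℝ) - 1) - η
              + α / (2 * (n : ℝ) * ((n : ℝ) - 1))) * (∑ i, l i) ^ 2
             + 2 * (2 - α)) ^ 3
          ≤ (∑ i, ∑ j, (l j - l i) ^ 2 * (l i * l j + 1) ^ 2) + 1 := by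

  have hn' : (3 : ℝ) ≤ n := by exact_mod_cast hn
  have hd : 0 < (n : ℝ) - 2 + α := by linarith
  let K : Set ((Fin n → ℝ) × ℝ) := {p | (∑ i, p.1 i) ^ 2 + p.2 ^ 2 = 1 ∧
    (1 / ((n : ℝ) - 1) + η) * (∑ i, p.1 i) ^ 2 ≤ ∑ i, (p.1 i) ^ 2 ∧
    ∑ i, (p.1 i) ^ 2 ≤ (∑ i, p.1 i) ^ 2 / ((n : ℝ) - 2 + α) + 2 * (2 - α) * p.2 ^ 2}
  let F : (Fin n → ℝ) × ℝ → ℝ := fun p =>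
    (∑ i, ∑ j, (p.1 j - p.1 i) ^ 2 * (p.1 i * p.1 j + p.2 ^ 2) ^ 2) + p.2 ^ 6
  have hFc : Continuous F := by fun_prop
  have hKcl : IsClosed K := by
    simp only [K, Set.setOf_and]
    refine (isClosed_eq ?_ ?_).inter ((isClosed_le ?_ ?_).inter (isClosed_le ?_ ?_)) <;> fun_prop
  have hKb : Bornology.IsBounded K := by
    rw [isBounded_iff_forall_norm_le]
    refine ⟨1 / ((n : ℝ) - 2 + α) + 5, ?_⟩
    rintro ⟨m, s⟩ ⟨h1, h2, h3⟩
    simp only at h1 h2 h3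
    have hdi : 0 < 1 / ((n : ℝ) - 2 + α) := by positivity
    have hs : s ^ 2 ≤ 1 := by nlinarith [sq_nonneg (∑ i, m i)]
    have hT : (∑ i, m i) ^ 2 ≤ 1 := by nlinarith [sq_nonneg s]
    have hB : ∑ i, (m i) ^ 2 ≤ 1 / ((n : ℝ) - 2 + α) + 4 := by
      have : (∑ i, m i) ^ 2 / ((n : ℝ) - 2 + α) ≤ 1 / ((n : ℝ) - 2 + α) := by gcongr
      nlinarith [sq_nonneg s]
    have hx : ∀ x : ℝ, x ^ 2 ≤ 1 / ((n : ℝ) - 2 + α) + 4 →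
        ‖x‖ ≤ 1 / ((n : ℝ) - 2 + α) + 5 := by
      intro x hx
      rw [Real.norm_eq_abs]
      nlinarith [sq_abs x, sq_nonneg (|x| - 1)]
    rw [Prod.norm_def]
    refine max_le ?_ (hx _ (by linarith))
    rw [pi_norm_le_iff_of_nonneg (by positivity)]
    intro i
    exact hx _ ((Finset.single_le_sum (f := fun i => (m i) ^ 2)
      (fun i _ => sq_nonneg _) (Finset.mem_univ i)).trans hB)
  have hKc : IsCompact K := Metric.isCompact_of_isClosed_isBounded hKcl hKb
  have hpos : ∀ p ∈ K, 0 < F p := by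
    rintro ⟨m, s⟩ ⟨h1, h2, h3⟩
    simp only at h1 h2 h3
    have hnn : 0 ≤ ∑ i, ∑ j, (m j - m i) ^ 2 * (m i * m j + s ^ 2) ^ 2 :=
      Finset.sum_nonneg fun i _ => Finset.sum_nonneg fun j _ => by positivity
    have hs6 : 0 ≤ s ^ 6 := by positivity
    by_contra! hle
    simp only [F] at hle
    have hs : s = 0 := by
      have : s ^ 6 = 0 := by linarith
      exact pow_eq_zero_iff (by norm_num) |>.1 this
    have hz : ∑ i, ∑ j, (m j - m i) ^ 2 * (m i * m j + s ^ 2) ^ 2 = 0 := by linarith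
    subst hs
    have hT : (∑ i, m i) ^ 2 = 1 := by linarith
    rw [hT] at h2 h3
    refine aux_pos n hn α η hα0 hη0 m hT (by linarith) (by linarith) ?_
    intro i j
    rw [Finset.sum_eq_zero_iff_of_nonneg
      (fun i _ => Finset.sum_nonneg fun j _ => by positivity)] at hz
    have := hz i (Finset.mem_univ i)
    rw [Finset.sum_eq_zero_iff_of_nonneg (fun j _ => by positivity)] at this
    simpa using this j (Finset.mem_univ j)
  obtain ⟨c, hc0, hc⟩ := hKc.exists_forall_le' hFc.continuousOn hpos
  set a := 1 / ((n : ℝ) - 2 + α) - 1 / ((n : ℝ) - 1) - η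
              + α / (2 * (n : ℝ) * ((n : ℝ) - 1)) with ha
  have hA : 0 < |a| + 4 := by positivity
  refine ⟨c / (|a| + 4) ^ 3, by positivity, ?_⟩
  intro l h1 h2
  set T := ∑ i, l i with hT
  set r := √(T ^ 2 + 1) with hr
  have hr2 : r ^ 2 = T ^ 2 + 1 := Real.sq_sqrt (by positivity)
  have hr0 : 0 < r := Real.sqrt_pos.2 (by positivity)
  have s1 : ∑ i, l i / r = T / r := by rw [← Finset.sum_div]
  have s2 : ∑ i, (l i / r) ^ 2 = (∑ i, (l i) ^ 2) / r ^ 2 := by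
    rw [Finset.sum_div]; simp only [div_pow]
  have hmem : ((fun i => l i / r, 1 / r) : (Fin n → ℝ) × ℝ) ∈ K := by
    refine ⟨?_, ?_, ?_⟩
    · simp only [s1]
      field_simp
      linarith
    · simp only [s1, s2]
      simp only [div_pow]
      rw [← mul_div_assoc]
      gcongr
      linarith
    · simp only [s1, s2]
      simp only [div_pow]
      have : T ^ 2 / r ^ 2 / ((n : ℝ) - 2 + α) + 2 * (2 - α) * (1 ^ 2 / r ^ 2)
        = (T ^ 2 / ((n : ℝ) - 2 + α) + 2 * (2 - α)) / r ^ 2 := by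
        field_simp
      rw [this]
      gcongr
      linarith
  have hF := hc _ hmem
  have hFe : F (fun i => l i / r, 1 / r) =
      ((∑ i, ∑ j, (l j - l i) ^ 2 * (l i * l j + 1) ^ 2) + 1) / r ^ 6 := by
    simp only [F, add_div, Finset.sum_div]
    congr 1
    · refine Finset.sum_congr rfl fun i _ => Finset.sum_congr rfl fun j _ => ?_
      field_simp
    · rw [div_pow, one_pow]
  rw [hFe, le_div_iff₀ (by positivity)] at hF
  refine le_trans ?_ hF
  have hW : a * T ^ 2 + 2 * (2 - α) ≤ (|a| + 4) * r ^ 2 := by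
    rw [hr2]
    nlinarith [le_abs_self a, abs_nonneg a, sq_nonneg T,
      mul_le_mul_of_nonneg_right (le_abs_self a) (sq_nonneg T)]
  have hW3 : (a * T ^ 2 + 2 * (2 - α)) ^ 3 ≤ ((|a| + 4) * r ^ 2) ^ 3 :=
    (Odd.strictMono_pow (by decide)).monotone hW
  calc c / (|a| + 4) ^ 3 * (a * T ^ 2 + 2 * (2 - α)) ^ 3
      ≤ c / (|a| + 4) ^ 3 * ((|a| + 4) * r ^ 2) ^ 3 := by gcongr
    _ = c * r ^ 6 := by field_simp
end

section
/- Let n ≥ 1 be an integer and let λ = (λ₁,…,λₙ) ∈ ℝⁿ satisfy Σ_{i,j=1}^n (λᵢλⱼ(λⱼ − λᵢ))² = 0. Then there exists κ ∈ ℝ such that for every index i, either λᵢ = 0 or λᵢ = κ; in other words, λ has a null component of some multiplicity m and all remaining components equal to a single common value κ. -/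
/-- If `∑_{i,j} (λᵢ λⱼ (λⱼ - λᵢ))² = 0`, then the vector `λ`
has only two distinct values, one of which is `0`: there is `κ` such that each
component is either `0` or `κ`. -/
theorem vanishing_cubic_forces_two_values
    (n : ℕ) (hn : 1 ≤ n) (l : Fin n → ℝ)
    (h : ∑ i, ∑ j, (l i * l j * (l j - l i)) ^ 2 = 0) :
    ∃ κ : ℝ, ∀ i, l i = 0 ∨ l i = κ := by
  have key : ∀ i j, l i * l j * (l j - l i) = 0 := by
    intro i j
    have h1 := (Finset.sum_eq_zero_iff_of_nonneg
      (fun i _ => Finset.sum_nonneg (fun j _ => sq_nonneg _))).1 h i (Finset.mem_univ i)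
    have h2 := (Finset.sum_eq_zero_iff_of_nonneg
      (fun j _ => sq_nonneg _)).1 h1 j (Finset.mem_univ j)
    exact pow_eq_zero_iff (two_ne_zero) |>.1 h2
  by_cases hz : ∃ k, l k ≠ 0
  · obtain ⟨k, hk⟩ := hz
    refine ⟨l k, fun i => ?_⟩
    rcases mul_eq_zero.1 (key k i) with h1 | h1
    · exact Or.inl ((mul_eq_zero.1 h1).resolve_left hk)
    · exact Or.inr (sub_eq_zero.1 h1)
  · push Not at hz
    exact ⟨0, fun i => Or.inl (hz i)⟩
end

section
/- Let n ≥ 1 and let T : (Fin n) × (Fin n) × (Fin n) → ℝ be totally symmetric, i.e. T(i,j,k) is invariant under all permutations of (i,j,k). Define h : Fin n → ℝ by h(k) := Σᵢ T(i,i,k). Then Σ_{i,j,k} T(i,j,k)² ≥ (3/(n+2))·Σₖ h(k)². -/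
set_option maxHeartbeats 2000000 in
/-- Kato-type inequality for totally symmetric 3-tensors: if
`T : Fin n × Fin n × Fin n → ℝ` is invariant under all permutations of its
arguments and `h k = ∑ᵢ T(i,i,k)` is its trace, then
`∑ T² ≥ (3/(n+2)) ∑ h²`. -/
theorem kato_inequality_symmetric_three_tensor
    (n : ℕ) (hn : 1 ≤ n) (T : Fin n × Fin n × Fin n → ℝ)
    (hsymm₁ : ∀ i j k : Fin n, T (i, j, k) = T (j, i, k))
    (hsymm₂ : ∀ i j k : Fin n, T (i, j, k) = T (i, k, j)) :
    ∑ i, ∑ j, ∑ k, (T (i, j, k)) ^ 2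
      ≥ (3 / ((n : ℝ) + 2)) * ∑ k, (∑ i, T (i, i, k)) ^ 2 := by
  obtain ⟨h, hh⟩ : ∃ h : Fin n → ℝ, ∀ k, h k = ∑ i, T (i, i, k) := ⟨_, fun _ => rfl⟩
  simp only [← hh]
  set c : ℝ := 1 / ((n : ℝ) + 2) with hc
  have hn2 : (n : ℝ) + 2 ≠ 0 := by positivity
  have hcn : c * ((n : ℝ) + 2) = 1 := by rw [hc]; field_simp
  obtain ⟨d, hd⟩ : ∃ d : Fin n → Fin n → ℝ, ∀ i j, d i j = if i = j then 1 else 0 :=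
    ⟨_, fun _ _ => rfl⟩
  have dsq : ∀ i j, d i j ^ 2 = d i j := by intro i j; rw [hd]; split_ifs <;> norm_num
  have t1 : ∑ i, ∑ j, ∑ k, d i j * (T (i, j, k) * h k) = ∑ k, h k ^ 2 := by
    have : ∀ i j, ∑ k, d i j * (T (i, j, k) * h k) = d i j * ∑ k, T (i, j, k) * h k := by
      intro i j; rw [Finset.mul_sum]
    simp only [this]
    simp only [hd, ite_mul, one_mul, zero_mul, Finset.sum_ite_eq, Finset.mem_univ, if_true]
    rw [Finset.sum_comm]
    refine Finset.sum_congr rfl fun k _ => ?_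
    rw [← Finset.sum_mul, ← hh, sq]
  have t2 : ∑ i, ∑ j, ∑ k, d j k * (T (i, j, k) * h i) = ∑ k, h k ^ 2 := by
    simp only [hd, ite_mul, one_mul, zero_mul, Finset.sum_ite_eq, Finset.mem_univ, if_true]
    refine Finset.sum_congr rfl fun k _ => ?_
    rw [← Finset.sum_mul, sq, hh]
    congr 1
    refine Finset.sum_congr rfl fun i _ => ?_
    rw [hsymm₁, hsymm₂]
  have t3 : ∑ i, ∑ j, ∑ k, d i k * (T (i, j, k) * h j) = ∑ k, h k ^ 2 := by
    simp only [hd, ite_mul, one_mul, zero_mul, Finset.sum_ite_eq, Finset.mem_univ, if_true]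
    rw [Finset.sum_comm]
    refine Finset.sum_congr rfl fun k _ => ?_
    rw [← Finset.sum_mul, sq, hh]
    congr 1
    refine Finset.sum_congr rfl fun i _ => ?_
    rw [hsymm₂]
  have s1 : ∑ i, ∑ j, ∑ k, d i j * h k ^ 2 = n * ∑ k, h k ^ 2 := by
    simp only [← Finset.mul_sum, ← Finset.sum_mul]
    simp [hd]
  have s2 : ∑ i, ∑ j, ∑ k, d j k * h i ^ 2 = n * ∑ k, h k ^ 2 := by
    simp [hd, Finset.mul_sum]
  have s3 : ∑ i, ∑ j, ∑ k, d i k * h j ^ 2 = n * ∑ k, h k ^ 2 := by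
    simp [hd]
  have u1 : ∑ i, ∑ j, ∑ k, d i j * (d j k * (h k * h i)) = ∑ k, h k ^ 2 := by
    simp [hd, sq]
  have u2 : ∑ i, ∑ j, ∑ k, d i j * (d i k * (h k * h j)) = ∑ k, h k ^ 2 := by
    simp [hd, sq]
  have u3 : ∑ i, ∑ j, ∑ k, d j k * (d i k * (h i * h j)) = ∑ k, h k ^ 2 := by
    simp [hd, sq]
  have key : 0 ≤ ∑ i, ∑ j, ∑ k, (T (i, j, k) - c * (d i j * h k + d j k * h i + d i k * h j)) ^ 2 := by
    exact Finset.sum_nonneg fun i _ => Finset.sum_nonneg fun j _ =>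
      Finset.sum_nonneg fun k _ => sq_nonneg _
  have ex : ∀ i j k, (T (i, j, k) - c * (d i j * h k + d j k * h i + d i k * h j)) ^ 2
      = T (i, j, k) ^ 2 - 2 * c * (d i j * (T (i, j, k) * h k) + d j k * (T (i, j, k) * h i)
        + d i k * (T (i, j, k) * h j)) + c ^ 2 * (d i j * h k ^ 2 + d j k * h i ^ 2 + d i k * h j ^ 2
        + 2 * (d i j * (d j k * (h k * h i)) + d i j * (d i k * (h k * h j))
        + d j k * (d i k * (h i * h j)))) := by
    intro i j k
    linear_combination c ^ 2 * (h k ^ 2 * dsq i j + h i ^ 2 * dsq j k + h j ^ 2 * dsq i k)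
  simp only [ex, Finset.sum_add_distrib, Finset.sum_sub_distrib, ← Finset.mul_sum _ _ (2 * c),
    ← Finset.mul_sum _ _ (c ^ 2), ← Finset.mul_sum _ _ (2 : ℝ)] at key
  rw [t1, t2, t3, s1, s2, s3, u1, u2, u3] at key
  have e : 3 / ((n : ℝ) + 2) = 3 * c := by rw [hc]; ring
  rw [e]
  generalize ∑ k, h k ^ 2 = H at *
  have : c ^ 2 * (n * H + n * H + n * H + 2 * (H + H + H)) = 3 * c * H := by
    linear_combination 3 * c * H * hcn
  linarith
end

section
/- Let n ≥ 4 be an integer and α ∈ (0,1), or n = 3 and α ∈ (2/3, 1). Let η ∈ (0, (2−α)(n−α)/(2n(n−1)(n−2+α))) and set a := 1/(n−2+α) − 1/(n−1) − η + α/(2n(n−1)). Then the constant δ := min{ 1 − ((n+2)/3)·(1/(n−2+α) − α/(2n(n−1))), 1/(2(n−1)a), α + n/2 − 2 } is strictly positive. -/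
/-- Positivity of the constant `δ = δ(n,α)` in the evolution
inequality for `f_{σ,η}` in the proof of the cylindrical estimate, under the
hypotheses `n ≥ 4` with `α ∈ (0,1)`, or `n = 3` with `α ∈ (2/3,1)`. -/
theorem delta_positive
    (n : ℕ) (α : ℝ)
    (hcase : (4 ≤ n ∧ 0 < α ∧ α < 1) ∨ (n = 3 ∧ 2 / 3 < α ∧ α < 1))
    (η : ℝ) (hη0 : 0 < η)
    (hη1 : η < (2 - α) * ((n : ℝ) - α) / (2 * (n : ℝ) * ((n : ℝ) - 1) * ((n : ℝ) - 2 + α)))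
    (a : ℝ)
    (ha : a = 1 / ((n : ℝ) - 2 + α) - 1 / ((n : ℝ) - 1) - η
            + α / (2 * (n : ℝ) * ((n : ℝ) - 1))) :
    0 < min (min
        (1 - (((n : ℝ) + 2) / 3) * (1 / ((n : ℝ) - 2 + α) - α / (2 * (n : ℝ) * ((n : ℝ) - 1))))
        (1 / (2 * ((n : ℝ) - 1) * a)))
        (α + (n : ℝ) / 2 - 2) := by
  have hα : 0 < α ∧ α < 1 := by
    rcases hcase with h | h
    · exact h.2
    · exact ⟨by linarith [h.2.1], h.2.2⟩
  obtain ⟨h0, h1⟩ := hα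
  have key : (3 : ℝ) ≤ n ∧ (n : ℝ) + 2 < 3 * ((n : ℝ) - 2 + α) ∧ 0 < α + (n : ℝ) / 2 - 2 := by
    rcases hcase with h | h
    · have h4 : (4 : ℝ) ≤ n := by exact_mod_cast h.1
      exact ⟨by linarith, by linarith, by linarith⟩
    · have h3 : (n : ℝ) = 3 := by exact_mod_cast h.1
      have := h.2.1
      rw [h3]
      exact ⟨by linarith, by linarith, by linarith⟩
  obtain ⟨hn, hk, h3⟩ := key
  generalize (n : ℝ) = x at *
  have hx : 0 < x := by linarith
  have hx1 : 0 < x - 1 := by linarith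
  have hm : 0 < x - 2 + α := by linarith
  refine lt_min (lt_min ?_ ?_) h3
  · have e1 : (x + 2) / 3 * (1 / (x - 2 + α)) < 1 := by
      rw [div_mul_div_comm, mul_one, div_lt_one (by linarith)]
      exact hk
    have e2 : 0 < (x + 2) / 3 * (α / (2 * x * (x - 1))) := by positivity
    rw [mul_sub]
    linarith
  · have e : (2 - α) * (x - α) / (2 * x * (x - 1) * (x - 2 + α))
        = 1 / (x - 2 + α) - 1 / (x - 1) + α / (2 * x * (x - 1)) := by
      have := hx.ne'
      have := hx1.ne'
      have := hm.ne'
      field_simp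
      ring
    have ha0 : 0 < a := by linarith
    positivity
end

section
/- Let n ≥ 1 be an integer, K > 0, Λ₀ > 0, and T > 0. Let φ : [0,T) → ℝ be differentiable with φ(t) ≥ 0 for all t, φ(0) ≤ Λ₀K/2, and φ'(t) ≤ 2(φ(t) + nK)·φ(t) for all t ∈ [0,T). Then for every t ∈ [0,T) with (1 + 2n/Λ₀)·e^{−2nKt} > 1, one has φ(t) ≤ nK / ((1 + 2n/Λ₀)·e^{−2nKt} − 1). -/
/-- ODE comparison for the maximum of `|A|²` along the flow:
if `φ ≥ 0`, `φ(0) ≤ Λ₀K/2` and `φ' ≤ 2(φ + nK)φ` on `[0,T)`, then as long as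
`(1 + 2n/Λ₀)e^{−2nKt} > 1` one has `φ(t) ≤ nK/((1 + 2n/Λ₀)e^{−2nKt} − 1)`. -/
theorem ode_comparison_curvature_bound
    (n : ℕ) (hn : 1 ≤ n) (K Λ₀ T : ℝ) (hK : 0 < K) (hΛ : 0 < Λ₀) (hT : 0 < T)
    (φ φ' : ℝ → ℝ)
    (hderiv : ∀ t ∈ Set.Ico (0 : ℝ) T, HasDerivWithinAt φ (φ' t) (Set.Ico (0 : ℝ) T) t)
    (hnonneg : ∀ t ∈ Set.Ico (0 : ℝ) T, 0 ≤ φ t)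
    (h0 : φ 0 ≤ Λ₀ * K / 2)
    (hineq : ∀ t ∈ Set.Ico (0 : ℝ) T, φ' t ≤ 2 * (φ t + (n : ℝ) * K) * φ t) :
    ∀ t ∈ Set.Ico (0 : ℝ) T,
      1 < (1 + 2 * (n : ℝ) / Λ₀) * Real.exp (-2 * (n : ℝ) * K * t) →
      φ t ≤ (n : ℝ) * K / ((1 + 2 * (n : ℝ) / Λ₀) * Real.exp (-2 * (n : ℝ) * K * t) - 1) := by
  intro t ht hgt
  have hn' : (0 : ℝ) < n := by exact_mod_cast hn
  obtain ⟨c, hc⟩ : ∃ c : ℝ, c = (n : ℝ) * K := ⟨_, rfl⟩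
  have hcpos : 0 < c := by rw [hc]; positivity
  have hpos : ∀ s ∈ Set.Ico (0 : ℝ) T, 0 < φ s + c := fun s hs => by
    have := hnonneg s hs
    linarith
  have hg : ∀ s ∈ Set.Ico (0 : ℝ) T,
      HasDerivWithinAt (fun s => Real.exp (-2 * c * s) * (φ s / (φ s + c)))
        (Real.exp (-2 * c * s) * (-2 * c) * (φ s / (φ s + c)) +
          Real.exp (-2 * c * s) * ((φ' s * (φ s + c) - φ s * φ' s) / (φ s + c) ^ 2))
        (Set.Ico (0 : ℝ) T) s := by
    intro s hs
    have h1 : HasDerivAt (fun s : ℝ => Real.exp (-2 * c * s))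
        (Real.exp (-2 * c * s) * (-2 * c)) s := by
      have := ((hasDerivAt_id s).const_mul (-2 * c)).exp
      simpa using this
    exact h1.hasDerivWithinAt.mul
      ((hderiv s hs).div ((hderiv s hs).add_const c) (hpos s hs).ne')
  have hanti : AntitoneOn (fun s => Real.exp (-2 * c * s) * (φ s / (φ s + c)))
      (Set.Ico (0 : ℝ) T) := by
    refine antitoneOn_of_hasDerivWithinAt_nonpos (convex_Ico 0 T)
      (fun s hs => (hg s hs).continuousWithinAt)
      (fun s hs => (hg s (interior_subset hs)).mono interior_subset) ?_
    intro s hs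
    have hs' := interior_subset hs
    have hp := hpos s hs'
    have hi := hineq s hs'
    rw [← hc] at hi
    have h2 : (φ' s * (φ s + c) - φ s * φ' s) / (φ s + c) ^ 2 ≤ 2 * c * (φ s / (φ s + c)) := by
      have e : 2 * c * (φ s / (φ s + c)) = c * (2 * (φ s + c) * φ s) / (φ s + c) ^ 2 := by
        field_simp
      rw [e]
      apply div_le_div_of_nonneg_right _ (by positivity)
      nlinarith [mul_le_mul_of_nonneg_left hi hcpos.le]
    nlinarith [mul_le_mul_of_nonneg_left h2 (Real.exp_pos (-2 * c * s)).le]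
  have h0m : (0 : ℝ) ∈ Set.Ico (0 : ℝ) T := ⟨le_rfl, hT⟩
  have hle := hanti h0m ht ht.1
  have e1 : -2 * (n : ℝ) * K * t = -2 * c * t := by rw [hc]; ring
  rw [e1] at hgt ⊢
  rw [← hc]
  have hC : 0 < 1 + 2 * (n : ℝ) / Λ₀ := by positivity
  have hz : (1 + 2 * (n : ℝ) / Λ₀) * (φ 0 / (φ 0 + c)) ≤ 1 := by
    rw [← mul_div_assoc, div_le_one (hpos 0 h0m)]
    have h3 : 2 * (n : ℝ) / Λ₀ * φ 0 ≤ 2 * (n : ℝ) / Λ₀ * (Λ₀ * K / 2) :=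
      mul_le_mul_of_nonneg_left h0 (by positivity)
    have h4 : 2 * (n : ℝ) / Λ₀ * (Λ₀ * K / 2) = c := by
      rw [hc]; field_simp
    linarith
  simp only [mul_zero, Real.exp_zero, one_mul] at hle
  have h5 : (1 + 2 * (n : ℝ) / Λ₀) * (Real.exp (-2 * c * t) * (φ t / (φ t + c))) ≤ 1 :=
    (mul_le_mul_of_nonneg_left hle hC.le).trans hz
  rw [← mul_assoc, ← mul_div_assoc, div_le_one (hpos t ht)] at h5
  rw [le_div_iff₀ (by linarith)]
  linarith
end

section
/- Let n ≥ 1 be an integer, K > 0, Λ₀ > 0, and T > 0. Let φ : [0,T) → ℝ be differentiable with φ(t) ≥ 0 for all t, φ(0) ≤ Λ₀K/2, and φ'(t) ≤ 2(φ(t) + nK)·φ(t) for all t ∈ [0,T). If φ is unbounded on [0,T) (i.e. sup_{t∈[0,T)} φ(t) = ∞), then e^{2nKT} ≥ 1 + 2n/Λ₀. -/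
/-- Lower bound on the maximal existence time: if `φ ≥ 0`,
`φ(0) ≤ Λ₀K/2`, `φ' ≤ 2(φ + nK)φ` on `[0,T)`, and `φ` is unbounded on `[0,T)`,
then `e^{2nKT} ≥ 1 + 2n/Λ₀`. -/
theorem existence_time_lower_bound
    (n : ℕ) (hn : 1 ≤ n) (K Λ₀ T : ℝ) (hK : 0 < K) (hΛ : 0 < Λ₀) (hT : 0 < T)
    (φ φ' : ℝ → ℝ)
    (hderiv : ∀ t ∈ Set.Ico (0 : ℝ) T, HasDerivWithinAt φ (φ' t) (Set.Ico (0 : ℝ) T) t)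
    (hnonneg : ∀ t ∈ Set.Ico (0 : ℝ) T, 0 ≤ φ t)
    (h0 : φ 0 ≤ Λ₀ * K / 2)
    (hineq : ∀ t ∈ Set.Ico (0 : ℝ) T, φ' t ≤ 2 * (φ t + (n : ℝ) * K) * φ t)
    (hunbdd : ¬ BddAbove (φ '' Set.Ico (0 : ℝ) T)) :
    Real.exp (2 * (n : ℝ) * K * T) ≥ 1 + 2 * (n : ℝ) / Λ₀ := by
  have hn0 : (0 : ℝ) < n := by exact_mod_cast hn
  obtain ⟨c, hc⟩ : ∃ c : ℝ, c = (n : ℝ) * K := ⟨_, rfl⟩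
  have hc0 : 0 < c := by rw [hc]; positivity
  have hmem0 : (0 : ℝ) ∈ Set.Ico (0 : ℝ) T := ⟨le_rfl, hT⟩
  have hd : ∀ t ∈ Set.Ico (0 : ℝ) T,
      HasDerivWithinAt (fun t => φ t / (φ t + c) * Real.exp (-(2 * c) * t))
        ((φ' t * (φ t + c) - φ t * φ' t) / (φ t + c) ^ 2 * Real.exp (-(2 * c) * t)
          + φ t / (φ t + c) * (Real.exp (-(2 * c) * t) * (-(2 * c) * 1)))
        (Set.Ico (0 : ℝ) T) t := by
    intro t ht
    have h1 := hderiv t ht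
    have h2 := hnonneg t ht
    have h3 : φ t + c ≠ 0 := by positivity
    have h4 : HasDerivWithinAt (fun t : ℝ => Real.exp (-(2 * c) * t))
        (Real.exp (-(2 * c) * t) * (-(2 * c) * 1)) (Set.Ico (0 : ℝ) T) t :=
      (((hasDerivAt_id t).const_mul (-(2 * c))).exp).hasDerivWithinAt
    exact (h1.div (h1.add_const c) h3).mul h4
  have hanti : AntitoneOn (fun t => φ t / (φ t + c) * Real.exp (-(2 * c) * t))
      (Set.Ico (0 : ℝ) T) := by
    apply antitoneOn_of_hasDerivWithinAt_nonpos (convex_Ico 0 T)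
      (fun t ht => (hd t ht).continuousWithinAt)
      (fun t ht => (hd t (interior_subset ht)).mono interior_subset)
    intro t ht
    have ht' := interior_subset ht
    have h2 := hnonneg t ht'
    have h3 := hineq t ht'
    rw [← hc] at h3
    have h4 : 0 < φ t + c := by positivity
    have : (φ' t * (φ t + c) - φ t * φ' t) / (φ t + c) ^ 2 * Real.exp (-(2 * c) * t)
          + φ t / (φ t + c) * (Real.exp (-(2 * c) * t) * (-(2 * c) * 1))
        = -((2 * (φ t + c) * φ t - φ' t) * (c * Real.exp (-(2 * c) * t) / (φ t + c) ^ 2)) := by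
      field_simp
      ring
    rw [this]
    exact neg_nonpos.mpr (mul_nonneg (sub_nonneg.mpr h3) (by positivity))
  by_contra hlt
  push Not at hlt
  have hE : Real.exp (2 * (n : ℝ) * K * T) = Real.exp (2 * c * T) := by
    rw [hc]; ring_nf
  rw [hE] at hlt
  obtain ⟨E, hEdef⟩ : ∃ E, E = Real.exp (2 * c * T) := ⟨_, rfl⟩
  rw [← hEdef] at hlt
  have hE0 : 0 < E := hEdef ▸ Real.exp_pos _
  have hlt2 : E * Λ₀ < Λ₀ + 2 * n := by
    have := mul_lt_mul_of_pos_right hlt hΛ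
    have h5 : (1 + 2 * (n : ℝ) / Λ₀) * Λ₀ = Λ₀ + 2 * n := by field_simp
    linarith
  have hD : 0 < Λ₀ + 2 * n - E * Λ₀ := by linarith
  apply hunbdd
  refine ⟨E * Λ₀ * c / (Λ₀ + 2 * n - E * Λ₀), ?_⟩
  rintro _ ⟨t, ht, rfl⟩
  have hm := hanti hmem0 ht ht.1
  simp only [mul_zero, Real.exp_zero, mul_one] at hm
  have p0 := hnonneg 0 hmem0
  have pt := hnonneg t ht
  have q0 : φ 0 / (φ 0 + c) ≤ Λ₀ / (Λ₀ + 2 * n) := by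
    rw [div_le_div_iff₀ (by positivity) (by positivity)]
    rw [hc]
    nlinarith
  have hexp : 1 ≤ E * Real.exp (-(2 * c) * t) := by
    rw [hEdef, ← Real.exp_add]
    apply Real.one_le_exp
    nlinarith [ht.2]
  have hv : φ t / (φ t + c) ≤ E * (Λ₀ / (Λ₀ + 2 * n)) := by
    have hv0 : 0 ≤ φ t / (φ t + c) := by positivity
    calc φ t / (φ t + c) ≤ φ t / (φ t + c) * (E * Real.exp (-(2 * c) * t)) :=
          le_mul_of_one_le_right hv0 hexp
      _ = E * (φ t / (φ t + c) * Real.exp (-(2 * c) * t)) := by ring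
      _ ≤ _ := mul_le_mul_of_nonneg_left (hm.trans q0) hE0.le
  rw [← mul_div_assoc, div_le_div_iff₀ (by positivity) (by positivity)] at hv
  rw [le_div_iff₀ hD]
  nlinarith
end

section
/- Let c > 0, t₀ < t₁ be reals, and let h : [t₀,t₁] → ℝ be differentiable with h(t) > 0 and |h'(t)| ≤ (c²/2)·h(t)³ for all t ∈ [t₀,t₁]. Then for every s ∈ [t₀,t₁] with c²·h(t₁)²·(t₁ − s) < 1, one has h(t₁)/√(1 + c²·h(t₁)²·(t₁−s)) ≤ h(s) ≤ h(t₁)/√(1 − c²·h(t₁)²·(t₁−s)). -/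
/-- Temporal integration step of the parabolic gradient
estimate: if `|h'| ≤ (c²/2)h³` on `[t₀,t₁]`, then for each `s ∈ [t₀,t₁]` with
`c² h(t₁)² (t₁ − s) < 1`,
`h(t₁)/√(1 + c² h(t₁)² (t₁−s)) ≤ h(s) ≤ h(t₁)/√(1 − c² h(t₁)² (t₁−s))`. -/
theorem parabolic_gradient_estimate_integration
    (c t₀ t₁ : ℝ) (hc : 0 < c) (ht : t₀ < t₁) (h h' : ℝ → ℝ)
    (hderiv : ∀ t ∈ Set.Icc t₀ t₁, HasDerivWithinAt h (h' t) (Set.Icc t₀ t₁) t)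
    (hpos : ∀ t ∈ Set.Icc t₀ t₁, 0 < h t)
    (hbound : ∀ t ∈ Set.Icc t₀ t₁, |h' t| ≤ (c ^ 2 / 2) * (h t) ^ 3) :
    ∀ s ∈ Set.Icc t₀ t₁, c ^ 2 * (h t₁) ^ 2 * (t₁ - s) < 1 →
      h t₁ / Real.sqrt (1 + c ^ 2 * (h t₁) ^ 2 * (t₁ - s)) ≤ h s ∧
      h s ≤ h t₁ / Real.sqrt (1 - c ^ 2 * (h t₁) ^ 2 * (t₁ - s)) := by
  intro s hs hlt
  have h1 : t₁ ∈ Set.Icc t₀ t₁ := ⟨ht.le, le_rfl⟩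
  have key : ‖(h t₁ ^ 2)⁻¹ - (h s ^ 2)⁻¹‖ ≤ c ^ 2 * ‖t₁ - s‖ := by
    refine Convex.norm_image_sub_le_of_norm_hasDerivWithin_le
      (f := fun t => (h t ^ 2)⁻¹) (s := Set.Icc t₀ t₁)
      (f' := fun t => -(2 * h t * h' t) / (h t ^ 2) ^ 2) ?_ ?_ (convex_Icc _ _) hs h1
    · intro t ht'
      have hp := hpos t ht'
      have := ((hderiv t ht').pow 2).inv (by simpa using hp.ne')
      have e : -(2 * h t * h' t) / (h t ^ 2) ^ 2 =
          -(((2 : ℕ) : ℝ) * h t ^ (2 - 1) * h' t) / (h ^ 2) t ^ 2 := by simp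
      simp only [e]
      exact this
    · intro t ht'
      have hp := hpos t ht'
      have hb := hbound t ht'
      rw [Real.norm_eq_abs, abs_div, abs_neg, abs_mul, abs_of_pos (by positivity : 0 < 2 * h t),
        abs_of_pos (by positivity : 0 < (h t ^ 2) ^ 2), div_le_iff₀ (by positivity)]
      calc 2 * h t * |h' t| ≤ 2 * h t * ((c ^ 2 / 2) * (h t) ^ 3) := by gcongr
        _ = _ := by ring
  have ha := hpos _ h1
  have hb := hpos _ hs
  have hts : 0 ≤ t₁ - s := sub_nonneg.2 hs.2
  rw [Real.norm_eq_abs, Real.norm_eq_abs, abs_of_nonneg hts, abs_le] at key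
  generalize h t₁ = a at *
  generalize h s = b at *
  obtain ⟨k1, k2⟩ := key
  have hm : 0 < a ^ 2 * b ^ 2 := by positivity
  have e1 : a ^ 2 * b ^ 2 * ((a ^ 2)⁻¹ - (b ^ 2)⁻¹) = b ^ 2 - a ^ 2 := by
    field_simp
  have m1 := mul_le_mul_of_nonneg_left k1 hm.le
  have m2 := mul_le_mul_of_nonneg_left k2 hm.le
  rw [e1] at m1 m2
  have p1 : 0 < 1 + c ^ 2 * a ^ 2 * (t₁ - s) := by positivity
  have p2 : 0 < 1 - c ^ 2 * a ^ 2 * (t₁ - s) := by linarith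
  constructor
  · rw [div_le_iff₀ (Real.sqrt_pos.2 p1)]
    refine (pow_le_pow_iff_left₀ (by positivity) (by positivity) two_ne_zero).1 ?_
    rw [mul_pow, Real.sq_sqrt p1.le]
    linarith
  · rw [le_div_iff₀ (Real.sqrt_pos.2 p2)]
    refine (pow_le_pow_iff_left₀ (by positivity) (by positivity) two_ne_zero).1 ?_
    rw [mul_pow, Real.sq_sqrt p2.le]
    linarith
end

section
/- Let n ≥ 4 be an integer. For every ε > 0 there exist real numbers r > 0 and s > 0 with r² + s² = 1 such that (2s⁴ + (n−2)r⁴)/(r²s²) − (1/(n−2))·((n−2)r² − 2s²)²/(r²s²) − 4 ≤ ε. -/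
/-- Sharpness of the quadratic pinching condition: for every
`n ≥ 4` and `ε > 0` there is a hypersurface `𝕊²(r) × 𝕊^{n−2}(s)` of the unit
sphere (`r² + s² = 1`) on which `|A|² − H²/(n−2) − 4 ≤ ε`. -/
theorem pinching_condition_sharp
    (n : ℕ) (hn : 4 ≤ n) :
    ∀ ε : ℝ, 0 < ε → ∃ r s : ℝ, 0 < r ∧ 0 < s ∧ r ^ 2 + s ^ 2 = 1 ∧
      (2 * s ^ 4 + ((n : ℝ) - 2) * r ^ 4) / (r ^ 2 * s ^ 2)
          - (1 / ((n : ℝ) - 2)) * (((n : ℝ) - 2) * r ^ 2 - 2 * s ^ 2) ^ 2 / (r ^ 2 * s ^ 2)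
          - 4 ≤ ε := by
  intro ε hε
  have hm : (0 : ℝ) < (n : ℝ) - 2 := by
    have : (4 : ℝ) ≤ (n : ℝ) := by exact_mod_cast hn
    linarith
  generalize (n : ℝ) - 2 = m at hm
  have ha : 0 < 2 / (2 + ε) := by positivity
  have hb : 0 < ε / (2 + ε) := by positivity
  have hr := Real.sqrt_pos.2 ha
  have hs := Real.sqrt_pos.2 hb
  have hr2 := Real.sq_sqrt ha.le
  have hs2 := Real.sq_sqrt hb.le
  refine ⟨√(2 / (2 + ε)), √(ε / (2 + ε)), hr, hs, ?_, ?_⟩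
  · rw [hr2, hs2]
    field_simp
  · have e4 : ∀ x : ℝ, x ^ 4 = (x ^ 2) ^ 2 := fun x => by ring
    rw [e4, e4, hr2, hs2]
    have key : (2 * (ε / (2 + ε)) ^ 2 + m * (2 / (2 + ε)) ^ 2) / (2 / (2 + ε) * (ε / (2 + ε)))
          - (1 / m) * (m * (2 / (2 + ε)) - 2 * (ε / (2 + ε))) ^ 2 /
            (2 / (2 + ε) * (ε / (2 + ε))) - 4 = ε - 2 * ε / m := by
      field_simp
      ring
    rw [key]
    have : 0 < 2 * ε / m := by positivity
    linarith
end
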